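/- arXiv:2105.05524 — 2 statements merged into one kernel-verified Lean document; each statement's English description precedes it below -/
import Mathlib

section
/- Let X be a compact metric space and f : X → X a continuous map, and let x ∈ R(f). The chain recurrence class [x] is minimal with respect to ≻ (i.e., for every y ∈ R(f), x ≻ y implies y ≻ x) if and only if [x] = A_x. -/
open Set Filter Topology

section ChainRecurrence

variable {X : Type*} [MetricSpace X]

/-- There exists an `ε`-pseudo-orbit from `x` to `y`: a finite sequence
`x_0 = x, …, x_n = y` with `n ≥ 1` and `dist (f x_i) x_{i+1} < ε` for all `i < n`. -/
def PseudoOrbit (f : X → X) (ε : ℝ) (x y : X) : Prop :=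
  ∃ n : ℕ, 1 ≤ n ∧ ∃ u : ℕ → X, u 0 = x ∧ u n = y ∧
    ∀ i, i < n → dist (f (u i)) (u (i + 1)) < ε

/-- `x ≻ y` : for every `ε > 0` there is an `ε`-pseudo-orbit from `x` to `y`. -/
def ChainSucc (f : X → X) (x y : X) : Prop :=
  ∀ ε : ℝ, 0 < ε → PseudoOrbit f ε x y

/-- The chain recurrent set `R(f) = {x | x ≻ x}`. -/
def chainRecurrentSet (f : X → X) : Set X := {x | ChainSucc f x x}

/-- A trapping region: a nonempty open set `U` with `closure (f '' U) ⊆ U`. -/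
def IsTrappingRegion (f : X → X) (U : Set X) : Prop :=
  U.Nonempty ∧ IsOpen U ∧ closure (f '' U) ⊆ U

/-- The attracting set associated to `U`, namely `⋂ n, f^n(U)`. -/
def attractingSetOf (f : X → X) (U : Set X) : Set X := ⋂ n : ℕ, f^[n] '' U

/-- `A` is an attracting set if it is the attracting set of some trapping region. -/
def IsAttractingSet (f : X → X) (A : Set X) : Prop :=
  ∃ U : Set X, IsTrappingRegion f U ∧ A = attractingSetOf f U

/-- The basin `B(A) = ⋃ n, f^{-n}(U)` of the attracting set associated to `U`. -/
def basinOf (f : X → X) (U : Set X) : Set X := ⋃ n : ℕ, f^[n] ⁻¹' U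

/-- `U_{x,ε}` : the set of endpoints of `ε`-pseudo-orbits starting at `x`. -/
def pseudoReach (f : X → X) (ε : ℝ) (x : X) : Set X := {y | PseudoOrbit f ε x y}

/-- `A_{x,ε} := ⋂ n, f^n (U_{x,ε})`. -/
def Aeps (f : X → X) (ε : ℝ) (x : X) : Set X := attractingSetOf f (pseudoReach f ε x)

/-- The quasi-attractor `A_x := ⋂_{ε > 0} A_{x,ε}`. -/
def quasiAttractorOf (f : X → X) (x : X) : Set X := ⋂ (ε : ℝ) (_ : 0 < ε), Aeps f ε x

/-- The chain recurrence class `[x] = {y ∈ R(f) | x ≻ y ∧ y ≻ x}`. -/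
def chainClass (f : X → X) (x : X) : Set X :=
  {y | y ∈ chainRecurrentSet f ∧ ChainSucc f x y ∧ ChainSucc f y x}

/-- A quasi-attractor: the intersection of a decreasing family of attracting sets. -/
def IsQuasiAttractor (f : X → X) (Q : Set X) : Prop :=
  ∃ A : ℕ → Set X, (∀ n, IsAttractingSet f (A n)) ∧ (∀ n, A (n + 1) ⊆ A n) ∧ Q = ⋂ n, A n

/-- The ω-limit set of `z` : all limits of convergent subsequences of `(f^n z)ₙ`. -/
def limitSet (f : X → X) (z : X) : Set X :=
  {p | ∃ φ : ℕ → ℕ, StrictMono φ ∧ Tendsto (fun k => f^[φ k] z) atTop (𝓝 p)}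

theorem PO_step (f : X → X) {ε : ℝ} {x y : X} (h : dist (f x) y < ε) : PseudoOrbit f ε x y := by
  refine ⟨1, le_rfl, fun i => if i = 0 then x else y, by simp, by simp, ?_⟩
  intro i hi
  have : i = 0 := by omega
  subst this
  simpa using h

theorem PO_mono {f : X → X} {ε δ : ℝ} {x y : X} (h : PseudoOrbit f ε x y) (hd : ε ≤ δ) :
    PseudoOrbit f δ x y := by
  obtain ⟨n, hn, u, h0, h1, hu⟩ := h
  exact ⟨n, hn, u, h0, h1, fun i hi => (hu i hi).trans_le hd⟩

theorem PO_trans {f : X → X} {ε : ℝ} {x y z : X} (h : PseudoOrbit f ε x y)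
    (h' : PseudoOrbit f ε y z) : PseudoOrbit f ε x z := by
  obtain ⟨n, hn, u, h0, h1, hu⟩ := h
  obtain ⟨m, hm, v, k0, k1, hv⟩ := h'
  refine ⟨n + m, by omega, fun i => if i ≤ n then u i else v (i - n), by simp [h0], ?_, ?_⟩
  · have : ¬ (n + m ≤ n) := by omega
    simp only [this, if_false]
    simpa using k1
  · intro i hi
    rcases lt_trichotomy i n with h | h | h
    · simp only [show i ≤ n by omega, show i + 1 ≤ n by omega, if_true]
      exact hu i h
    · subst h
      simp only [le_refl, show ¬ (i + 1 ≤ i) by omega, if_true, if_false]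
      have := hv 0 (by omega)
      rw [h1, ← k0]
      simpa using this
    · simp only [show ¬ i ≤ n by omega, show ¬ (i + 1 ≤ n) by omega, if_false]
      have := hv (i - n) (by omega)
      rwa [show i + 1 - n = i - n + 1 by omega]

theorem PO_last {f : X → X} {ε : ℝ} {x y : X} (h : PseudoOrbit f ε x y) :
    ∃ z, (z = x ∨ PseudoOrbit f ε x z) ∧ dist (f z) y < ε := by
  obtain ⟨n, hn, u, h0, h1, hu⟩ := h
  obtain ⟨m, rfl⟩ : ∃ m, n = m + 1 := ⟨n - 1, by omega⟩
  refine ⟨u m, ?_, ?_⟩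
  · rcases Nat.eq_zero_or_pos m with h | h
    · left; rw [h, h0]
    · right; exact ⟨m, h, u, h0, rfl, fun i hi => hu i (by omega)⟩
  · rw [← h1]; exact hu m (by omega)

theorem PO_perturb {f : X → X} {ε δ : ℝ} {x y z : X} (h : PseudoOrbit f ε x y)
    (hd : dist y z < δ) : PseudoOrbit f (ε + δ) x z := by
  obtain ⟨w, hw, hwy⟩ := PO_last h
  have hs : PseudoOrbit f (ε + δ) w z :=
    PO_step f ((dist_triangle _ y _).trans_lt (add_lt_add hwy hd))
  have hδ : 0 ≤ δ := dist_nonneg.trans hd.le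
  rcases hw with rfl | hw
  · exact hs
  · exact PO_trans (PO_mono hw (by linarith)) hs

theorem PO_orbit (f : X → X) {ε : ℝ} (hε : 0 < ε) (x : X) (n : ℕ) (hn : 1 ≤ n) :
    PseudoOrbit f ε x (f^[n] x) := by
  refine ⟨n, hn, fun i => f^[i] x, rfl, rfl, fun i _ => ?_⟩
  simp only [Function.iterate_succ_apply', dist_self]
  exact hε

theorem CS_trans {f : X → X} {x y z : X} (h : ChainSucc f x y) (h' : ChainSucc f y z) :
    ChainSucc f x z := fun ε hε => PO_trans (h ε hε) (h' ε hε)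

theorem exists_rec [CompactSpace X] (f : X → X) (hf : Continuous f) (y : X) :
    ∃ w, ChainSucc f w w ∧ ChainSucc f y w := by
  obtain ⟨w, φ, hφ, hw⟩ := CompactSpace.tendsto_subseq (fun n => f^[n] y)
  have hd : ∀ ε : ℝ, 0 < ε → ∃ N, ∀ k ≥ N, dist (f^[φ k] y) w < ε := fun ε hε =>
    Metric.tendsto_atTop.1 hw ε hε
  have hfw : Tendsto (fun k => f (f^[φ k] y)) atTop (𝓝 (f w)) := (hf.tendsto w).comp hw
  refine ⟨w, fun ε hε => ?_, fun ε hε => ?_⟩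
  · obtain ⟨N, hN⟩ := hd (ε / 2) (by linarith)
    obtain ⟨M, hM⟩ := Metric.tendsto_atTop.1 hfw ε hε
    have h1 := hM M le_rfl
    rw [dist_comm] at h1
    have h1 := PO_step f h1
    let k := N + φ M + 2
    have hk : φ M + 2 ≤ φ k := le_trans (by simp only [k]; omega) (show k ≤ φ k from hφ.id_le k)
    have h2 := PO_orbit f (half_pos hε) (f (f^[φ M] y)) (φ k - φ M - 1) (by omega)
    rw [← Function.iterate_succ_apply' f, ← Function.iterate_add_apply,
      show φ k - φ M - 1 + (φ M).succ = φ k by omega] at h2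
    have h3 := PO_perturb h2 (hN k (by simp only [k]; omega))
    rw [add_halves, Function.iterate_succ_apply'] at h3
    exact PO_trans h1 h3
  · obtain ⟨N, hN⟩ := hd (ε / 2) (by linarith)
    have h2 := PO_orbit f (half_pos hε) y (φ (N + 1)) (le_trans (by omega) (show N + 1 ≤ φ (N + 1) from hφ.id_le (N + 1)))
    have h3 := PO_perturb h2 (hN (N + 1) (by omega))
    rwa [add_halves] at h3

theorem exists_pre [CompactSpace X] (f : X → X) (hf : Continuous f) (x y : X)
    (hx : ChainSucc f x x) (hy : ChainSucc f x y) : ∃ z, ChainSucc f x z ∧ f z = y := by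
  have key : ∀ n : ℕ, ∃ z, PseudoOrbit f (1 / ((n : ℝ) + 1)) x z ∧
      dist (f z) y < 1 / ((n : ℝ) + 1) := by
    intro n
    have hp : (0 : ℝ) < 1 / ((n : ℝ) + 1) := by positivity
    obtain ⟨z, hz, hd⟩ := PO_last (hy _ hp)
    rcases hz with rfl | hz
    · exact ⟨z, hx _ hp, hd⟩
    · exact ⟨z, hz, hd⟩
  choose z hz hd using key
  obtain ⟨w, φ, hφ, hw⟩ := CompactSpace.tendsto_subseq z
  have hlim : Tendsto (fun k => 1 / ((φ k : ℝ) + 1)) atTop (𝓝 0) :=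
    tendsto_one_div_add_atTop_nhds_zero_nat.comp hφ.tendsto_atTop
  refine ⟨w, fun ε hε => ?_, ?_⟩
  · have e1 := hlim.eventually (gt_mem_nhds (half_pos hε))
    have e2 := hw.eventually (Metric.ball_mem_nhds w (half_pos hε))
    obtain ⟨k, h1, h2⟩ := (e1.and e2).exists
    have := PO_perturb (hz (φ k)) (z := w) (δ := ε / 2) h2
    exact PO_mono this (by linarith)
  · have hfw : Tendsto (fun k => f (z (φ k))) atTop (𝓝 (f w)) := (hf.tendsto w).comp hw
    refine tendsto_nhds_unique hfw (tendsto_iff_dist_tendsto_zero.2 ?_)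
    exact squeeze_zero (fun _ => dist_nonneg) (fun k => (hd (φ k)).le) hlim

theorem quasi_eq [CompactSpace X] (f : X → X) (hf : Continuous f) (x : X)
    (hx : ChainSucc f x x) : quasiAttractorOf f x = {y | ChainSucc f x y} := by
  have hpre : ∀ n : ℕ, ∀ y, ChainSucc f x y → ∃ z, ChainSucc f x z ∧ f^[n] z = y := by
    intro n
    induction n with
    | zero => exact fun y hy => ⟨y, hy, rfl⟩
    | succ n ih =>
      intro y hy
      obtain ⟨z, hz, rfl⟩ := exists_pre f hf x y hx hy
      obtain ⟨t, ht, rfl⟩ := ih z hz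
      exact ⟨t, ht, Function.iterate_succ_apply' f n t⟩
  ext y
  simp only [quasiAttractorOf, Aeps, attractingSetOf, mem_iInter, mem_setOf_eq]
  constructor
  · intro h ε hε
    obtain ⟨z, hz, rfl⟩ := h ε hε 0
    exact hz
  · intro h ε hε n
    obtain ⟨z, hz, hzy⟩ := hpre n y h
    exact ⟨z, hz ε hε, hzy⟩

/-- The class `[x]` is minimal with respect to `≻` iff `[x] = A_x`. -/
theorem chainClass_minimal_iff_eq_quasiAttractor {X : Type*} [MetricSpace X] [CompactSpace X]
    (f : X → X) (hf : Continuous f) (x : X) (hx : x ∈ chainRecurrentSet f) :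
    (∀ y ∈ chainRecurrentSet f, ChainSucc f x y → ChainSucc f y x) ↔
      chainClass f x = quasiAttractorOf f x := by
  rw [quasi_eq f hf x hx]
  constructor
  · intro h
    ext y
    refine ⟨fun hy => hy.2.1, fun hy => ?_⟩
    obtain ⟨w, hww, hyw⟩ := exists_rec f hf y
    have hyx : ChainSucc f y x := CS_trans hyw (h w hww (CS_trans hy hyw))
    exact ⟨CS_trans hyx hy, hy, hyx⟩
  · intro h y _ hxy
    have : y ∈ chainClass f x := by rw [h]; exact hxy
    exact this.2.2

end ChainRecurrence
end

section
/- Let X be a compact metric space and f : X → X a continuous map, and let x ∈ R(f). Then [x] = A_x if and only if A_x is minimal with respect to inclusion in the set of quasi-attractors of f, i.e., no quasi-attractor of f is a proper subset of A_x. -/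
open Set Filter Topology

section ChainRecurrence

variable {X : Type*} [MetricSpace X]

theorem PseudoOrbit.mono' {f : X → X} {ε δ : ℝ} (h : ε ≤ δ) {x y : X}
    (H : PseudoOrbit f ε x y) : PseudoOrbit f δ x y := by
  obtain ⟨n, hn, u, h0, h1, h2⟩ := H
  exact ⟨n, hn, u, h0, h1, fun i hi => (h2 i hi).trans_le h⟩

theorem PseudoOrbit.single {f : X → X} {ε : ℝ} {x y : X} (h : dist (f x) y < ε) :
    PseudoOrbit f ε x y := by
  refine ⟨1, le_rfl, fun i => if i = 0 then x else y, by simp, by simp, ?_⟩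
  intro i hi
  obtain rfl : i = 0 := by omega
  simpa using h

theorem PseudoOrbit.snoc {f : X → X} {ε : ℝ} {x y z : X} (H : PseudoOrbit f ε x y)
    (h : dist (f y) z < ε) : PseudoOrbit f ε x z := by
  obtain ⟨n, hn, u, h0, h1, h2⟩ := H
  refine ⟨n + 1, by omega, fun i => if i ≤ n then u i else z, by simp [h0], by simp, ?_⟩
  intro i hi
  rcases Nat.lt_or_ge i n with h' | h'
  · have := h2 i h'
    simpa [h'.le, Nat.succ_le_of_lt h'] using this
  · obtain rfl : i = n := by omega
    simpa [h1] using h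

/-- Induction along a pseudo-orbit. -/
theorem PseudoOrbit.induct {f : X → X} {ε : ℝ} {x y : X} (H : PseudoOrbit f ε x y)
    (P : X → Prop) (hP : P x) (hs : ∀ a b, P a → dist (f a) b < ε → P b) : P y := by
  obtain ⟨n, hn, u, h0, h1, h2⟩ := H
  have : ∀ i, i ≤ n → P (u i) := by
    intro i
    induction i with
    | zero => intro _; rwa [h0]
    | succ k ih => intro hk; exact hs _ _ (ih (by omega)) (h2 k (by omega))
  rw [← h1]
  exact this n le_rfl

theorem PseudoOrbit.trans' {f : X → X} {ε : ℝ} {x y z : X} (H : PseudoOrbit f ε x y)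
    (H' : PseudoOrbit f ε y z) : PseudoOrbit f ε x z :=
  H'.induct (fun w => PseudoOrbit f ε x w) H (fun _ _ ha hab => ha.snoc hab)

/-- Last step of a pseudo-orbit. -/
theorem PseudoOrbit.last {f : X → X} {ε : ℝ} {x y : X} (H : PseudoOrbit f ε x y) :
    ∃ z, (z = x ∨ PseudoOrbit f ε x z) ∧ dist (f z) y < ε := by
  obtain ⟨n, hn, u, h0, h1, h2⟩ := H
  obtain ⟨m, rfl⟩ : ∃ m, n = m + 1 := ⟨n - 1, by omega⟩
  refine ⟨u m, ?_, by rw [← h1]; exact h2 m (by omega)⟩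
  rcases Nat.eq_zero_or_pos m with rfl | hm
  · exact Or.inl h0
  · exact Or.inr ⟨m, hm, u, h0, rfl, fun i hi => h2 i (by omega)⟩

theorem ChainSucc.trans' {f : X → X} {x y z : X} (H : ChainSucc f x y)
    (H' : ChainSucc f y z) : ChainSucc f x z := fun ε hε => (H ε hε).trans' (H' ε hε)

theorem PseudoOrbit.near {f : X → X} {ε δ : ℝ} {x y z : X} (H : PseudoOrbit f ε x y)
    (h : dist y z < δ) : PseudoOrbit f (ε + δ) x z := by
  obtain ⟨w, hw, hd⟩ := H.last
  have hδ : 0 < δ := dist_nonneg.trans_lt h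
  have hd' : dist (f w) z < ε + δ := (dist_triangle _ y _).trans_lt (add_lt_add hd h)
  rcases hw with rfl | hw
  · exact PseudoOrbit.single hd'
  · exact (hw.mono' (by linarith)).snoc hd'

theorem ChainSucc.pre [CompactSpace X] {f : X → X} (hf : Continuous f) {x y : X}
    (hx : ChainSucc f x x) (H : ChainSucc f x y) : ∃ z, f z = y ∧ ChainSucc f x z := by
  have key : ∀ k : ℕ, ∃ z, PseudoOrbit f (1 / ((k : ℝ) + 1)) x z ∧
      dist (f z) y < 1 / ((k : ℝ) + 1) := by
    intro k
    have hk : (0 : ℝ) < 1 / ((k : ℝ) + 1) := Nat.one_div_pos_of_nat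
    obtain ⟨z, hz, hd⟩ := (H _ hk).last
    rcases hz with rfl | hz
    · exact ⟨z, hx _ hk, hd⟩
    · exact ⟨z, hz, hd⟩
  choose s hs hd using key
  obtain ⟨z, φ, hφ, hlim⟩ := CompactSpace.tendsto_subseq s
  have h0 : Tendsto (fun k => 1 / (((φ k : ℕ) : ℝ) + 1)) atTop (𝓝 0) :=
    (tendsto_one_div_add_atTop_nhds_zero_nat (𝕜 := ℝ)).comp hφ.tendsto_atTop
  refine ⟨z, ?_, ?_⟩
  · have h1 : Tendsto (fun k => f (s (φ k))) atTop (𝓝 (f z)) :=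
      (hf.tendsto z).comp hlim
    have h2 : Tendsto (fun k => f (s (φ k))) atTop (𝓝 y) := by
      rw [tendsto_iff_dist_tendsto_zero]
      exact squeeze_zero (fun _ => dist_nonneg) (fun k => (hd (φ k)).le) h0
    exact tendsto_nhds_unique h1 h2
  · intro ε hε
    have e1 := h0.eventually (gt_mem_nhds (half_pos hε))
    have e2 := (Metric.tendsto_nhds.1 hlim) (ε / 2) (half_pos hε)
    obtain ⟨k, hk1, hk2⟩ := (e1.and e2).exists
    have := ((hs (φ k)).mono' hk1.le).near hk2
    simpa using this

theorem ChainSucc.pre_iter [CompactSpace X] {f : X → X} (hf : Continuous f) {x y : X}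
    (hx : ChainSucc f x x) (H : ChainSucc f x y) (n : ℕ) :
    ∃ z, f^[n] z = y ∧ ChainSucc f x z := by
  induction n with
  | zero => exact ⟨y, rfl, H⟩
  | succ n ih =>
    obtain ⟨z, hz, hxz⟩ := ih
    obtain ⟨w, hw, hxw⟩ := ChainSucc.pre hf hx hxz
    exact ⟨w, by rw [Function.iterate_succ_apply, hw, hz], hxw⟩

theorem chainSucc_of_mem_quasi {f : X → X} {x y : X} (h : y ∈ quasiAttractorOf f x) :
    ChainSucc f x y := by
  intro ε hε
  have h1 : y ∈ Aeps f ε x := mem_iInter₂.1 h ε hε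
  obtain ⟨z, hz, rfl⟩ := mem_iInter.1 h1 0
  exact hz

theorem mem_quasi_of_chainSucc [CompactSpace X] {f : X → X} (hf : Continuous f) {x y : X}
    (hx : ChainSucc f x x) (H : ChainSucc f x y) : y ∈ quasiAttractorOf f x := by
  refine mem_iInter₂.2 fun ε hε => mem_iInter.2 fun n => ?_
  obtain ⟨z, hz, hxz⟩ := ChainSucc.pre_iter hf hx H n
  exact ⟨z, hxz ε hε, hz⟩

theorem isTrapping_reach (f : X → X) (x : X) {ε : ℝ} (hε : 0 < ε) :
    IsTrappingRegion f (pseudoReach f ε x) := by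
  refine ⟨⟨f x, PseudoOrbit.single (by simpa using hε)⟩, ?_, ?_⟩
  · rw [Metric.isOpen_iff]
    intro y hy
    obtain ⟨w, hw, hd⟩ := PseudoOrbit.last hy
    refine ⟨ε - dist (f w) y, by linarith, fun z hz => ?_⟩
    rw [Metric.mem_ball, dist_comm] at hz
    have hd' : dist (f w) z < ε := by linarith [dist_triangle (f w) y z]
    rcases hw with rfl | hw
    · exact PseudoOrbit.single hd'
    · exact hw.snoc hd'
  · intro y hy
    obtain ⟨_, ⟨z, hz, rfl⟩, hd⟩ := Metric.mem_closure_iff.1 hy ε hε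
    exact PseudoOrbit.snoc hz (by rwa [dist_comm])

theorem isQuasi (f : X → X) (x : X) : IsQuasiAttractor f (quasiAttractorOf f x) := by
  refine ⟨fun n => Aeps f (1 / ((n : ℝ) + 1)) x, fun n => ⟨_, isTrapping_reach f x
    Nat.one_div_pos_of_nat, rfl⟩, ?_, ?_⟩
  · intro n
    refine iInter_mono fun k => image_mono fun y hy => PseudoOrbit.mono' ?_ hy
    exact Nat.one_div_le_one_div (Nat.le_succ n)
  · apply Subset.antisymm
    · exact fun y hy => mem_iInter.2 fun n => mem_iInter₂.1 hy _ Nat.one_div_pos_of_nat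
    · intro y hy
      refine mem_iInter₂.2 fun ε hε => ?_
      obtain ⟨n, hn⟩ := exists_nat_one_div_lt hε
      have h1 := mem_iInter.1 hy n
      exact (iInter_mono fun k => image_mono fun y hy => PseudoOrbit.mono' hn.le hy) h1

theorem attracting_compact [CompactSpace X] {f : X → X} (hf : Continuous f) {A : Set X}
    (hA : IsAttractingSet f A) : A.Nonempty ∧ IsCompact A := by
  obtain ⟨U, ⟨hne, -, hcl⟩, rfl⟩ := hA
  have hK : IsCompact (closure (f '' U)) := isClosed_closure.isCompact
  have hKi : ∀ n, IsCompact (f^[n] '' closure (f '' U)) := fun n => hK.image (hf.iterate n)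
  have heq : attractingSetOf f U = ⋂ n : ℕ, f^[n] '' closure (f '' U) := by
    apply Subset.antisymm
    · intro y hy
      refine mem_iInter.2 fun n => ?_
      obtain ⟨z, hz, rfl⟩ := mem_iInter.1 hy (n + 1)
      exact ⟨f z, subset_closure ⟨z, hz, rfl⟩, rfl⟩
    · exact iInter_mono fun n => image_mono hcl
  rw [heq]
  refine ⟨?_, ?_⟩
  · apply IsCompact.nonempty_iInter_of_sequence_nonempty_isCompact_isClosed
    · rintro n _ ⟨z, hz, rfl⟩
      exact ⟨f z, subset_closure ⟨z, hcl hz, rfl⟩, rfl⟩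
    · exact fun n => ((hne.image f).closure).image _
    · exact hKi 0
    · exact fun n => (hKi n).isClosed
  · exact (isClosed_iInter fun n => (hKi n).isClosed).isCompact

theorem chain_stays [CompactSpace X] {f : X → X} {U : Set X} (hU : IsTrappingRegion f U)
    {y z : X} (hy : y ∈ U) (h : ChainSucc f y z) : z ∈ U := by
  obtain ⟨-, ho, hcl⟩ := hU
  obtain ⟨δ, hδ, hsub⟩ :=
    (isClosed_closure (s := f '' U)).isCompact.exists_thickening_subset_open ho hcl
  refine (h δ hδ).induct (· ∈ U) hy fun a b ha hab => hsub ?_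
  rw [Metric.mem_thickening_iff]
  exact ⟨f a, subset_closure ⟨a, ha, rfl⟩, by rwa [dist_comm]⟩

/-- `[x] = A_x` iff `A_x` is minimal with respect to inclusion among quasi-attractors,
i.e. no quasi-attractor is a proper subset of `A_x`. -/
theorem chainClass_eq_iff_quasiAttractor_minimal {X : Type*} [MetricSpace X] [CompactSpace X]
    (f : X → X) (hf : Continuous f) (x : X) (hx : x ∈ chainRecurrentSet f) :
    chainClass f x = quasiAttractorOf f x ↔
      ∀ Q : Set X, IsQuasiAttractor f Q → ¬ Q ⊂ quasiAttractorOf f x := by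
  constructor
  · rintro heq Q ⟨A, hA, hmono, rfl⟩ hss
    have hne : (⋂ n, A n).Nonempty :=
      IsCompact.nonempty_iInter_of_sequence_nonempty_isCompact_isClosed A hmono
        (fun n => (attracting_compact hf (hA n)).1) (attracting_compact hf (hA 0)).2
        (fun n => (attracting_compact hf (hA n)).2.isClosed)
    obtain ⟨y, hy⟩ := hne
    have hyc : y ∈ chainClass f x := heq ▸ hss.1 hy
    obtain ⟨hyy, hxy, hyx⟩ := hyc
    refine hss.2 fun z hz => mem_iInter.2 fun n => ?_
    have hyz : ChainSucc f y z := hyx.trans' (chainSucc_of_mem_quasi hz)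
    have hyn := mem_iInter.1 hy n
    obtain ⟨U, hU, hAU⟩ := hA n
    rw [hAU] at hyn ⊢
    have hyU : y ∈ U := by
      obtain ⟨w, hw, rfl⟩ := mem_iInter.1 hyn 0
      exact hw
    refine mem_iInter.2 fun m => ?_
    obtain ⟨w, hw, hyw⟩ := ChainSucc.pre_iter hf hyy hyz m
    exact ⟨w, chain_stays hU hyU hyw, hw⟩
  · intro hmin
    apply Subset.antisymm
    · exact fun y hy => mem_quasi_of_chainSucc hf hx hy.2.1
    · intro y hy
      have hxy := chainSucc_of_mem_quasi hy
      have hsub : quasiAttractorOf f y ⊆ quasiAttractorOf f x := fun z hz =>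
        mem_quasi_of_chainSucc hf hx (hxy.trans' (chainSucc_of_mem_quasi hz))
      have hsup : quasiAttractorOf f x ⊆ quasiAttractorOf f y := by
        by_contra hcon
        exact hmin _ (isQuasi f y) ⟨hsub, hcon⟩
      have hyx := chainSucc_of_mem_quasi (hsup (mem_quasi_of_chainSucc hf hx hx))
      exact ⟨hyx.trans' hxy, hxy, hyx⟩

end ChainRecurrence
end
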